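/- arXiv:1303.5697 — 4 statements merged into one kernel-verified Lean document; each statement's English description precedes it below -/
import Mathlib

section
/- Let J be a B(H)-ideal and S ∈ J. The following are equivalent: (i) the smallest J-ideal (S)_J containing S is a two-sided ideal of B(H); (ii) (S) = J(S), where J(S) is the product of J with the smallest B(H)-ideal (S) containing S; (iii) there exist m ∈ ℕ and A, B, A_1, …, A_m, B_1, …, B_m ∈ J with S = AS + SB + Σ_{i=1}^{m} A_iSB_i. -/
open Pointwise

variable {H : Type*} [NormedAddCommGroup H] [InnerProductSpace ℂ H] [CompleteSpace H]
  [TopologicalSpace.SeparableSpace H]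

/-- A `B(H)`-ideal: a two-sided ideal of the algebra `B(H)` of bounded operators on `H`. -/
def IsBHIdeal (J : Set (H →L[ℂ] H)) : Prop :=
  0 ∈ J ∧ (∀ x ∈ J, ∀ y ∈ J, x + y ∈ J) ∧
    (∀ (A : H →L[ℂ] H), ∀ x ∈ J, A * x ∈ J) ∧
    (∀ (A : H →L[ℂ] H), ∀ x ∈ J, x * A ∈ J)

/-- `I` is a `J`-ideal (a subideal): a `ℂ`-linear subspace of `B(H)` contained in `J` that is
closed under left and right multiplication by elements of `J`. -/
def IsSubideal (J I : Set (H →L[ℂ] H)) : Prop :=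
  I ⊆ J ∧ 0 ∈ I ∧ (∀ x ∈ I, ∀ y ∈ I, x + y ∈ I) ∧
    (∀ (c : ℂ), ∀ x ∈ I, c • x ∈ I) ∧
    (∀ A ∈ J, ∀ x ∈ I, A * x ∈ I ∧ x * A ∈ I)

/-- `(𝒮)_J`, the smallest `J`-ideal containing the set `𝒮`. -/
def subidealGen (J 𝒮 : Set (H →L[ℂ] H)) : Set (H →L[ℂ] H) :=
  ⋂₀ {I | IsSubideal J I ∧ 𝒮 ⊆ I}

/-- `(𝒮)`, the smallest `B(H)`-ideal containing the set `𝒮`. -/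
def idealGen (𝒮 : Set (H →L[ℂ] H)) : Set (H →L[ℂ] H) :=
  ⋂₀ {I | IsBHIdeal I ∧ 𝒮 ⊆ I}

/-- The product `IJ` of two ideals: the set of finite sums `Σ Xᵢ Yᵢ` with `Xᵢ ∈ I`, `Yᵢ ∈ J`. -/
def idealProd (I J : Set (H →L[ℂ] H)) : Set (H →L[ℂ] H) :=
  {T | ∃ (n : ℕ) (X Y : Fin n → (H →L[ℂ] H)),
    (∀ i, X i ∈ I) ∧ (∀ i, Y i ∈ J) ∧ T = ∑ i, X i * Y i}

/-- `J(𝒮)J`: the set of finite sums `Σ Aᵢ Xᵢ Bᵢ` with `Aᵢ, Bᵢ ∈ J` and `Xᵢ ∈ (𝒮)`. -/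
def JSJ (J 𝒮 : Set (H →L[ℂ] H)) : Set (H →L[ℂ] H) :=
  {T | ∃ (n : ℕ) (A X B : Fin n → (H →L[ℂ] H)),
    (∀ i, A i ∈ J) ∧ (∀ i, B i ∈ J) ∧ (∀ i, X i ∈ idealGen 𝒮) ∧
    T = ∑ i, A i * X i * B i}

/-- `U_J(H)`: the unitaries of the form `1 + A` with `A ∈ J`. -/
def unitaryJ (J : Set (H →L[ℂ] H)) : Set (H →L[ℂ] H) :=
  {U | U ∈ unitary (H →L[ℂ] H) ∧ U - 1 ∈ J}

namespace PSub

/-- A Douglas-type factorization. -/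
lemma exists_factor (A B : H →L[ℂ] H) (h : ∀ x, ‖B x‖ ≤ ‖A x‖) :
    ∃ C : H →L[ℂ] H, B = C * A := by
  let K : Submodule ℂ H := (LinearMap.range (A : H →ₗ[ℂ] H)).topologicalClosure
  have hK : IsClosed (K : Set H) := Submodule.isClosed_topologicalClosure _
  haveI : CompleteSpace K := hK.completeSpace_coe
  have hmem : ∀ x, (A : H →ₗ[ℂ] H) x ∈ K := fun x =>
    Submodule.le_topologicalClosure _ (LinearMap.mem_range_self _ x)
  let e : H →ₗ[ℂ] K := (A : H →ₗ[ℂ] H).codRestrict K hmem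
  have hd : DenseRange e := by
    intro y
    rw [closure_subtype]
    have : (Subtype.val '' Set.range e : Set H) = LinearMap.range (A : H →ₗ[ℂ] H) := by
      ext z
      constructor
      · rintro ⟨_, ⟨x, rfl⟩, rfl⟩
        exact ⟨x, rfl⟩
      · rintro ⟨x, rfl⟩
        exact ⟨e x, ⟨x, rfl⟩, rfl⟩
    rw [this]
    exact y.2
  have hn : ∃ C : ℝ, ∀ x, ‖(B : H →ₗ[ℂ] H) x‖ ≤ C * ‖e x‖ :=
    ⟨1, fun x => by rw [one_mul]; exact h x⟩
  refine ⟨(LinearMap.extendOfNorm (B : H →ₗ[ℂ] H) e).comp K.orthogonalProjectionOnto, ?_⟩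
  ext x
  have h1 : K.orthogonalProjectionOnto (A x) = e x :=
    Submodule.orthogonalProjectionOnto_mem_subspace_eq_self (e x)
  have h2 := LinearMap.extendOfNorm_eq hd hn x
  simp only [ContinuousLinearMap.mul_apply, ContinuousLinearMap.comp_apply, h1, h2]
  rfl

lemma norm_abs_apply (T : H →L[ℂ] H) (x : H) : ‖CFC.abs T x‖ = ‖T x‖ := by
  have h1 : star (CFC.abs T) = CFC.abs T := (CFC.abs_nonneg T).star_eq
  have h2 : star (CFC.abs T) * CFC.abs T = star T * T := by rw [h1, CFC.abs_mul_abs]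
  have key : ∀ R : H →L[ℂ] H, (inner ℂ ((star R * R) x) x : ℂ) = (‖R x‖ : ℂ) ^ 2 := by
    intro R
    rw [ContinuousLinearMap.star_eq_adjoint, ContinuousLinearMap.mul_apply,
      ContinuousLinearMap.adjoint_inner_left, inner_self_eq_norm_sq_to_K]
    rfl
  have h3 := key (CFC.abs T)
  rw [h2, key T] at h3
  have h4 : ‖T x‖ ^ 2 = ‖CFC.abs T x‖ ^ 2 := by exact_mod_cast h3
  exact ((sq_eq_sq₀ (norm_nonneg _) (norm_nonneg _)).1 h4).symm

lemma star_factor (T : H →L[ℂ] H) : ∃ X Y : H →L[ℂ] H, star T = X * T * Y := by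
  obtain ⟨U, hU⟩ := exists_factor (CFC.abs T) T (fun x => (norm_abs_apply T x).ge)
  obtain ⟨V, hV⟩ := exists_factor T (CFC.abs T) (fun x => (norm_abs_apply T x).le)
  have h1 : star (CFC.abs T) = CFC.abs T := (CFC.abs_nonneg T).star_eq
  refine ⟨V, star U, ?_⟩
  rw [← hV]
  conv_lhs => rw [hU, star_mul, h1]

lemma star_mem {I : Set (H →L[ℂ] H)} (hI : IsBHIdeal I) {T : H →L[ℂ] H} (hT : T ∈ I) :
    star T ∈ I := by
  obtain ⟨X, Y, h⟩ := star_factor T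
  rw [h]
  exact hI.2.2.2 _ _ (hI.2.2.1 _ _ hT)

lemma exists_isometries (hinf : ¬FiniteDimensional ℂ H) :
    ∃ V W : H →L[ℂ] H, star V * V = 1 ∧ star W * W = 1 ∧ star V * W = 0 := by
  classical
  obtain ⟨w, b, -⟩ := exists_hilbertBasis ℂ H
  have hw : Infinite w := by
    by_contra hfin
    rw [not_infinite_iff_finite] at hfin
    haveI := Fintype.ofFinite w
    exact hinf b.toOrthonormalBasis.toBasis.finiteDimensional_of_finite
  obtain ⟨g⟩ : Nonempty (w ⊕ w ≃ w) := by
    rw [← Cardinal.eq, ← Cardinal.add_def]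
    exact Cardinal.add_eq_self (Cardinal.aleph0_le_mk _)
  have iso : ∀ f : w → w, Function.Injective f →
      ∃ V : H →L[ℂ] H, star V * V = 1 ∧ ∀ i, V (b i) = b (f i) := by
    intro f hf
    have ho : Orthonormal ℂ (b ∘ f) := b.orthonormal.comp f hf
    let V := ho.orthogonalFamily.linearIsometry.comp b.repr.toLinearIsometry
    refine ⟨V.toContinuousLinearMap, ?_, ?_⟩
    · rw [ContinuousLinearMap.star_eq_adjoint]
      exact (ContinuousLinearMap.norm_map_iff_adjoint_comp_self _).1 (fun x => V.norm_map x)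
    · intro i
      change ho.orthogonalFamily.linearIsometry (b.repr (b i)) = _
      rw [b.repr_self, ho.orthogonalFamily.linearIsometry_apply_single]
      simp
  obtain ⟨V, hV, hVb⟩ := iso (fun i => g (Sum.inl i)) (g.injective.comp Sum.inl_injective)
  obtain ⟨W, hW, hWb⟩ := iso (fun i => g (Sum.inr i)) (g.injective.comp Sum.inr_injective)
  refine ⟨V, W, hV, hW, ?_⟩
  have hdense : Dense (Submodule.span ℂ (Set.range b) : Set H) :=
    Submodule.dense_iff_topologicalClosure_eq_top.2 b.dense_span
  refine ContinuousLinearMap.ext_on hdense ?_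
  rintro _ ⟨j, rfl⟩
  apply b.repr.injective
  ext i
  rw [b.repr_apply_apply, b.repr_apply_apply, ContinuousLinearMap.mul_apply,
    ContinuousLinearMap.star_eq_adjoint, ContinuousLinearMap.adjoint_inner_right, hVb, hWb]
  rw [b.orthonormal.2 (fun h => by simpa using g.injective h)]
  simp

lemma mem_closure_iff {α M : Type*} [AddCommMonoid M] (G : Set α) (p : α → M) (T : M) :
    T ∈ AddSubmonoid.closure (p '' G) ↔
      ∃ (n : ℕ) (f : Fin n → α), (∀ i, f i ∈ G) ∧ T = ∑ i, p (f i) := by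
  constructor
  · intro h
    induction h using AddSubmonoid.closure_induction with
    | mem x hx =>
      obtain ⟨a, ha, rfl⟩ := hx
      exact ⟨1, fun _ => a, fun _ => ha, by simp⟩
    | zero => exact ⟨0, Fin.elim0, fun i => i.elim0, by simp⟩
    | add x y _ _ hx hy =>
      obtain ⟨n, f, hf, rfl⟩ := hx
      obtain ⟨m, g, hg, rfl⟩ := hy
      refine ⟨n + m, Fin.append f g, ?_, ?_⟩
      · intro i
        refine Fin.addCases (fun i => ?_) (fun i => ?_) i
        · simpa using hf i
        · simpa using hg i
      · simp [Fin.sum_univ_add]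
  · rintro ⟨n, f, hf, rfl⟩
    exact AddSubmonoid.sum_mem _ fun i _ => AddSubmonoid.subset_closure ⟨f i, hf i, rfl⟩

lemma idealProd_eq (I J : Set (H →L[ℂ] H)) :
    idealProd I J = AddSubmonoid.closure ((fun q : (H →L[ℂ] H) × (H →L[ℂ] H) => q.1 * q.2) ''
      (I ×ˢ J)) := by
  ext T
  rw [SetLike.mem_coe, mem_closure_iff]
  constructor
  · rintro ⟨n, X, Y, hX, hY, h⟩
    exact ⟨n, fun i => (X i, Y i), fun i => ⟨hX i, hY i⟩, h⟩
  · rintro ⟨n, f, hf, h⟩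
    exact ⟨n, fun i => (f i).1, fun i => (f i).2, fun i => (hf i).1, fun i => (hf i).2, h⟩

lemma mul_mem_prod {I J : Set (H →L[ℂ] H)} {x y : H →L[ℂ] H} (hx : x ∈ I) (hy : y ∈ J) :
    x * y ∈ idealProd I J := by
  rw [idealProd_eq]
  exact AddSubmonoid.subset_closure ⟨(x, y), ⟨hx, hy⟩, rfl⟩

/-- Induction principle for products. -/
lemma prod_sub {I J N : Set (H →L[ℂ] H)} (h0 : 0 ∈ N) (ha : ∀ x ∈ N, ∀ y ∈ N, x + y ∈ N)
    (hm : ∀ x ∈ I, ∀ y ∈ J, x * y ∈ N) : idealProd I J ⊆ N := by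
  intro T hT
  rw [idealProd_eq] at hT
  induction hT using AddSubmonoid.closure_induction with
  | mem x hx =>
    obtain ⟨q, hq, rfl⟩ := hx
    exact hm _ hq.1 _ hq.2
  | zero => exact h0
  | add x y _ _ hx hy => exact ha _ hx _ hy

lemma prod_ideal {I J : Set (H →L[ℂ] H)} (hI : IsBHIdeal I) (hJ : IsBHIdeal J) :
    IsBHIdeal (idealProd I J) := by
  have h0 : (0 : H →L[ℂ] H) ∈ idealProd I J := by rw [idealProd_eq]; exact zero_mem _
  have ha : ∀ x ∈ idealProd I J, ∀ y ∈ idealProd I J, x + y ∈ idealProd I J := by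
    rw [idealProd_eq]; exact fun x hx y hy => add_mem hx hy
  refine ⟨h0, ha, fun A => ?_, fun A => ?_⟩
  · refine prod_sub (N := {x | A * x ∈ idealProd I J}) ?_ ?_ ?_
    · simpa using h0
    · intro x hx y hy
      simpa only [Set.mem_setOf_eq, mul_add] using ha _ hx _ hy
    · intro x hx y hy
      simp only [Set.mem_setOf_eq, ← mul_assoc]
      exact mul_mem_prod (hI.2.2.1 _ _ hx) hy
  · refine prod_sub (N := {x | x * A ∈ idealProd I J}) ?_ ?_ ?_
    · simpa using h0
    · intro x hx y hy
      simpa only [Set.mem_setOf_eq, add_mul] using ha _ hx _ hy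
    · intro x hx y hy
      simp only [Set.mem_setOf_eq, mul_assoc]
      exact mul_mem_prod hx (hJ.2.2.2 _ _ hy)

lemma prod_comm_sub {I J : Set (H →L[ℂ] H)} (hI : IsBHIdeal I) (hJ : IsBHIdeal J) :
    idealProd I J ⊆ idealProd J I := by
  have hP := prod_ideal hJ hI
  refine prod_sub hP.1 hP.2.1 fun x hx y hy => ?_
  have h := star_mem hP (mul_mem_prod (star_mem hJ hy) (star_mem hI hx))
  simpa using h

lemma smul_mem {I : Set (H →L[ℂ] H)} (hI : IsBHIdeal I) (c : ℂ) {x : H →L[ℂ] H} (hx : x ∈ I) :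
    c • x ∈ I := by
  have := hI.2.2.1 (c • 1) x hx
  simpa using this

lemma gen_ideal (s : Set (H →L[ℂ] H)) : IsBHIdeal (idealGen s) := by
  refine ⟨?_, ?_, ?_, ?_⟩
  · rintro I ⟨hI, -⟩
    exact hI.1
  · rintro x hx y hy I hI
    exact hI.1.2.1 _ (hx I hI) _ (hy I hI)
  · rintro A x hx I hI
    exact hI.1.2.2.1 _ _ (hx I hI)
  · rintro A x hx I hI
    exact hI.1.2.2.2 _ _ (hx I hI)

lemma mem_gen (S : H →L[ℂ] H) : S ∈ idealGen {S} := fun _ hI => hI.2 rfl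

lemma gen_sub {S : H →L[ℂ] H} {I : Set (H →L[ℂ] H)} (hI : IsBHIdeal I) (hS : S ∈ I) :
    idealGen {S} ⊆ I := fun _ hx => hx I ⟨hI, by simpa using hS⟩

/-- finite sums of `A S B` with `A, B ∈ J`. -/
def sums (J : Set (H →L[ℂ] H)) (S : H →L[ℂ] H) : AddSubmonoid (H →L[ℂ] H) :=
  AddSubmonoid.closure ((fun q : (H →L[ℂ] H) × (H →L[ℂ] H) => q.1 * S * q.2) '' (J ×ˢ J))

lemma gen_sub_sums {J : Set (H →L[ℂ] H)} (hJ : IsBHIdeal J) {S : H →L[ℂ] H}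
    (h : idealGen {S} ⊆ idealProd J (idealGen {S})) : idealGen {S} ⊆ sums J S := by
  have hG := gen_ideal {S}
  have step : ∀ a ∈ J, ∀ b ∈ J, ∀ y ∈ idealGen {S}, a * y * b ∈ sums J S := by
    intro a ha b hb y hy
    let N : Set (H →L[ℂ] H) := {y | ∀ a ∈ J, ∀ b ∈ J, a * y * b ∈ sums J S}
    have hN : IsBHIdeal N := by
      refine ⟨?_, ?_, ?_, ?_⟩
      · intro a _ b _
        simp
      · intro x hx y hy a ha b hb
        rw [mul_add, add_mul]
        exact add_mem (hx a ha b hb) (hy a ha b hb)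
      · intro A x hx a ha b hb
        rw [← mul_assoc]
        exact hx _ (hJ.2.2.2 _ _ ha) b hb
      · intro A x hx a ha b hb
        rw [← mul_assoc, mul_assoc]
        exact hx _ ha _ (hJ.2.2.1 _ _ hb)
    have hSN : S ∈ N := fun a ha b hb => AddSubmonoid.subset_closure ⟨(a, b), ⟨ha, hb⟩, rfl⟩
    exact gen_sub hN hSN hy a ha b hb
  refine h.trans (prod_sub (zero_mem _) (fun x hx y hy => add_mem hx hy) fun x hx y hy => ?_)
  have hy' := prod_comm_sub hJ hG (h hy)
  refine prod_sub (N := {y | x * y ∈ sums J S}) ?_ ?_ ?_ hy'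
  · simp
  · intro u hu v hv
    simpa only [Set.mem_setOf_eq, mul_add] using add_mem hu hv
  · intro u hu v hv
    simp only [Set.mem_setOf_eq, ← mul_assoc]
    exact step x hx v hv u hu

lemma gen_eq_iff {J : Set (H →L[ℂ] H)} (hJ : IsBHIdeal J) (S : H →L[ℂ] H) :
    idealGen {S} = idealProd J (idealGen {S}) ↔ S ∈ idealProd J (idealGen {S}) := by
  have hG := gen_ideal {S}
  constructor
  · intro h
    rw [← h]
    exact mem_gen S
  · intro h
    refine Set.Subset.antisymm (gen_sub (prod_ideal hJ hG) h) ?_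
    exact prod_sub hG.1 hG.2.1 fun x _ y hy => hG.2.2.1 _ _ hy

lemma one_imp_two {J : Set (H →L[ℂ] H)} (hJ : IsBHIdeal J) (hinf : ¬FiniteDimensional ℂ H)
    {S : H →L[ℂ] H} (hS : S ∈ J) (h : IsBHIdeal (subidealGen J {S})) :
    S ∈ idealProd J (idealGen {S}) := by
  have hG := gen_ideal {S}
  set K := idealProd J (idealGen {S}) with hKdef
  have hK : IsBHIdeal K := prod_ideal hJ hG
  have hGJ : ∀ x ∈ idealGen {S}, ∀ a ∈ J, x * a ∈ K := fun x hx a ha =>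
    prod_comm_sub hG hJ (mul_mem_prod hx ha)
  have hKJ : K ⊆ J := prod_sub hJ.1 hJ.2.1 fun x hx y _ => hJ.2.2.2 _ _ hx
  let N : Set (H →L[ℂ] H) := {T | ∃ c : ℂ, ∃ k ∈ K, T = c • S + k}
  have hN : IsSubideal J N := by
    refine ⟨?_, ⟨0, 0, hK.1, by simp⟩, ?_, ?_, ?_⟩
    · rintro _ ⟨c, k, hk, rfl⟩
      exact hJ.2.1 _ (smul_mem hJ c hS) _ (hKJ hk)
    · rintro _ ⟨c, k, hk, rfl⟩ _ ⟨d, l, hl, rfl⟩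
      exact ⟨c + d, k + l, hK.2.1 _ hk _ hl, by rw [add_smul]; abel⟩
    · rintro d _ ⟨c, k, hk, rfl⟩
      exact ⟨d * c, d • k, smul_mem hK d hk, by rw [smul_add, mul_smul]⟩
    · rintro A hA _ ⟨c, k, hk, rfl⟩
      have hc := smul_mem hG c (mem_gen S)
      refine ⟨⟨0, A * (c • S) + A * k, hK.2.1 _ (mul_mem_prod hA hc) _ (hK.2.2.1 _ _ hk), ?_⟩,
        ⟨0, (c • S) * A + k * A, hK.2.1 _ (hGJ _ hc _ hA) _ (hK.2.2.2 _ _ hk), ?_⟩⟩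
      · rw [mul_add, zero_smul, zero_add]
      · rw [add_mul, zero_smul, zero_add]
  have hSN : S ∈ N := ⟨1, 0, hK.1, by simp⟩
  have hSg : S ∈ subidealGen J {S} := fun I hI => hI.2 rfl
  have hX : ∀ X : H →L[ℂ] H, ∃ c : ℂ, ∃ k ∈ K, X * S = c • S + k := fun X =>
    h.2.2.1 X S hSg N ⟨hN, by simpa using hSN⟩
  obtain ⟨V, W, hV, hW, hVW⟩ := exists_isometries hinf
  by_contra hSK
  have hsm : ∀ c : ℂ, c • S ∈ K → c = 0 := by
    intro c hc
    by_contra hne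
    apply hSK
    have := smul_mem hK c⁻¹ hc
    rwa [smul_smul, inv_mul_cancel₀ hne, one_smul] at this
  have hneg : ∀ x ∈ K, -x ∈ K := fun x hx => by simpa using smul_mem hK (-1) hx
  obtain ⟨c, k, hk, hc⟩ := hX W
  obtain ⟨d, l, hl, hd⟩ := hX V
  obtain ⟨e, r, hr, he⟩ := hX (star V)
  have h1 : (1 - d * e) • S ∈ K := by
    have h2 : S = star V * (V * S) := by rw [← mul_assoc, hV, one_mul]
    rw [hd, mul_add, mul_smul_comm, he, smul_add, smul_smul] at h2
    have h3 : (1 - d * e) • S = d • r + star V * l := by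
      rw [sub_smul, one_smul, sub_eq_iff_eq_add]
      conv_lhs => rw [h2]
      abel
    rw [h3]
    exact hK.2.1 _ (smul_mem hK d hr) _ (hK.2.2.1 _ _ hl)
  have h2 : (c * e) • S ∈ K := by
    have h2 : 0 = star V * (W * S) := by rw [← mul_assoc, hVW, zero_mul]
    rw [hc, mul_add, mul_smul_comm, he, smul_add, smul_smul] at h2
    have h3 : (c * e) • S = -(c • r + star V * k) := by
      rw [eq_neg_iff_add_eq_zero, h2]
      abel
    rw [h3]
    exact hneg _ (hK.2.1 _ (smul_mem hK c hr) _ (hK.2.2.1 _ _ hk))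
  have h3 := hsm _ h1
  have h4 := hsm _ h2
  have hc0 : c = 0 := by
    rcases mul_eq_zero.1 h4 with h5 | h5
    · exact h5
    · rw [h5] at h3; simp at h3
  apply hSK
  have h5 : S = star W * (W * S) := by rw [← mul_assoc, hW, one_mul]
  rw [hc, hc0, zero_smul, zero_add] at h5
  rw [h5]
  exact hK.2.2.1 _ _ hk

lemma two_imp_one {J : Set (H →L[ℂ] H)} (hJ : IsBHIdeal J)
    {S : H →L[ℂ] H} (hS : S ∈ J) (h : idealGen {S} ⊆ idealProd J (idealGen {S})) :
    IsBHIdeal (subidealGen J {S}) := by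
  have hG := gen_ideal {S}
  have heq : subidealGen J {S} = idealGen {S} := by
    apply Set.Subset.antisymm
    · intro x hx
      refine hx _ ⟨⟨gen_sub hJ hS, hG.1, hG.2.1, fun c x hx => smul_mem hG c hx,
        fun A _ x hx => ⟨hG.2.2.1 _ _ hx, hG.2.2.2 _ _ hx⟩⟩, by simpa using mem_gen S⟩
    · intro x hx I hI
      obtain ⟨hI, hSI⟩ := hI
      have hSI : S ∈ I := hSI rfl
      have hx' := gen_sub_sums hJ h hx
      unfold sums at hx'
      rw [SetLike.mem_coe] at hx'
      clear hx
      induction hx' using AddSubmonoid.closure_induction with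
      | mem x hx =>
        obtain ⟨q, hq, rfl⟩ := hx
        exact (hI.2.2.2.2 _ hq.2 _ (hI.2.2.2.2 _ hq.1 _ hSI).1).2
      | zero => exact hI.2.1
      | add x y _ _ hx hy => exact hI.2.2.1 _ hx _ hy
  rw [heq]
  exact hG

end PSub

/-- softness criterion for a principal `J`-ideal to be a `B(H)`-ideal. -/
theorem principal_subideal_tfae (J : Set (H →L[ℂ] H)) (hJ : IsBHIdeal J)
    (hinf : ¬FiniteDimensional ℂ H) (S : H →L[ℂ] H) (hS : S ∈ J) :
    [ IsBHIdeal (subidealGen J {S}),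
      idealGen {S} = idealProd J (idealGen {S}),
      ∃ (m : ℕ) (A B : H →L[ℂ] H) (A' B' : Fin m → (H →L[ℂ] H)),
        A ∈ J ∧ B ∈ J ∧ (∀ i, A' i ∈ J) ∧ (∀ i, B' i ∈ J) ∧
        S = A * S + S * B + ∑ i, A' i * S * B' i ].TFAE := by
  have hG := PSub.gen_ideal {S}
  have hK := PSub.prod_ideal hJ hG
  tfae_have 1 → 2 := fun h => (PSub.gen_eq_iff hJ S).2 (PSub.one_imp_two hJ hinf hS h)
  tfae_have 2 → 1 := fun h => PSub.two_imp_one hJ hS h.subset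
  tfae_have 2 → 3 := by
    intro h
    have h1 : S ∈ PSub.sums J S := PSub.gen_sub_sums hJ h.subset (PSub.mem_gen S)
    unfold PSub.sums at h1
    rw [PSub.mem_closure_iff] at h1
    obtain ⟨n, f, hf, h2⟩ := h1
    refine ⟨n, 0, 0, fun i => (f i).1, fun i => (f i).2, hJ.1, hJ.1, fun i => (hf i).1,
      fun i => (hf i).2, ?_⟩
    rw [zero_mul, mul_zero, zero_add, zero_add]
    exact h2
  tfae_have 3 → 2 := by
    rintro ⟨m, A, B, A', B', hA, hB, hA', hB', h⟩
    rw [PSub.gen_eq_iff hJ S]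
    have hSG := PSub.mem_gen S
    have hsum : ∀ s : Finset (Fin m), ∑ i ∈ s, A' i * S * B' i ∈ idealProd J (idealGen {S}) := by
      intro s
      induction s using Finset.cons_induction with
      | empty => simpa using hK.1
      | cons a s ha ih =>
        rw [Finset.sum_cons]
        exact hK.2.1 _ (hK.2.2.2 _ _ (PSub.mul_mem_prod (hA' a) hSG)) _ ih
    have h1 := hK.2.1 _ (hK.2.1 _ (PSub.mul_mem_prod hA hSG) _
      (PSub.prod_comm_sub hG hJ (PSub.mul_mem_prod hSG hB))) _ (hsum Finset.univ)
    rwa [← h] at h1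
  tfae_finish
end

section
/- Let J be a B(H)-ideal and 𝒮 ⊆ J a set whose cardinality is strictly less than the cardinality of the continuum. Then the smallest J-ideal (𝒮)_J containing 𝒮 is a two-sided ideal of B(H) if and only if the B(H)-ideal (𝒮) is J-soft, i.e., (𝒮)J = (𝒮). -/
open Pointwise

variable {H : Type*} [NormedAddCommGroup H] [InnerProductSpace ℂ H] [CompleteSpace H]
  [TopologicalSpace.SeparableSpace H]

lemma sb_factor (A B : H →L[ℂ] H) (h : ∀ x, ‖A x‖ ≤ ‖B x‖) :
    ∃ W : H →L[ℂ] H, A = W * B := by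
  let K : Submodule ℂ H := (LinearMap.range (B : H →ₗ[ℂ] H)).topologicalClosure
  have hmem : ∀ x, B x ∈ K := fun x =>
    Submodule.le_topologicalClosure _ (LinearMap.mem_range_self (B : H →ₗ[ℂ] H) x)
  have : CompleteSpace K :=
    (Submodule.isClosed_topologicalClosure _).completeSpace_coe
  let e : H →ₗ[ℂ] K := LinearMap.codRestrict K (B : H →ₗ[ℂ] H) hmem
  have hd : DenseRange e := by
    intro y
    rw [Metric.mem_closure_iff]
    intro ε hε
    have hy : (y : H) ∈ closure ((LinearMap.range (B : H →ₗ[ℂ] H) : Submodule ℂ H) : Set H) :=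
      y.2
    obtain ⟨b, ⟨x, hx⟩, hb⟩ := Metric.mem_closure_iff.1 hy ε hε
    refine ⟨e x, ⟨x, rfl⟩, ?_⟩
    rw [← hx] at hb
    exact hb
  let W0 : K →L[ℂ] H := (A : H →ₗ[ℂ] H).extendOfNorm e
  refine ⟨W0.comp K.orthogonalProjectionOnto, ?_⟩
  ext x
  have h1 : K.orthogonalProjectionOnto (B x) = e x :=
    Submodule.orthogonalProjectionOnto_mem_subspace_eq_self (e x)
  have h2 : W0 (e x) = A x :=
    LinearMap.extendOfNorm_eq (f := (A : H →ₗ[ℂ] H)) hd ⟨1, fun x => by simpa using! h x⟩ x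
  simp [h1, h2]

lemma sb_star_mem {I : Set (H →L[ℂ] H)} (hI : IsBHIdeal I) {X : H →L[ℂ] H} (hX : X ∈ I) :
    star X ∈ I := by
  set P : H →L[ℂ] H := CFC.abs X with hP
  have hPs : star P = P := (IsSelfAdjoint.of_nonneg (CFC.abs_nonneg X)).star_eq
  have hPP : star P * P = star X * X := by rw [hPs]; exact CFC.abs_mul_abs X
  have hn : ∀ x, ‖X x‖ = ‖P x‖ := by
    intro x
    have h1 : ∀ Y : H →L[ℂ] H, inner ℂ ((star Y * Y) x) x = (‖Y x‖ : ℂ) ^ 2 := by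
      intro Y
      rw [mul_apply_eq_comp, ContinuousLinearMap.star_eq_adjoint,
        ContinuousLinearMap.adjoint_inner_left, inner_self_eq_norm_sq_to_K]
      rfl
    have h2 := h1 X
    rw [← hPP, h1 P] at h2
    have h3 : ‖P x‖ ^ 2 = ‖X x‖ ^ 2 := by exact_mod_cast h2
    exact ((sq_eq_sq₀ (norm_nonneg _) (norm_nonneg _)).1 h3).symm
  obtain ⟨W, hW⟩ := sb_factor X P (fun x => (hn x).le)
  obtain ⟨V, hV⟩ := sb_factor P X (fun x => (hn x).ge)
  have : star X = V * X * star W := by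
    rw [← hV]
    conv_lhs => rw [hW]
    rw [star_mul, hPs]
  rw [this]
  exact hI.2.2.2 _ _ (hI.2.2.1 _ _ hX)

lemma sb_isometries (hinf : ¬FiniteDimensional ℂ H) :
    ∃ S T : ℕ → (H →L[ℂ] H), (∀ n, ‖S n‖ ≤ 1) ∧
      ∀ m n, T m * S n = if m = n then 1 else 0 := by
  classical
  obtain ⟨w, b, hb⟩ := exists_hilbertBasis ℂ H
  have hw : Infinite w := by
    by_contra hfin
    rw [not_infinite_iff_finite] at hfin
    have := Fintype.ofFinite w
    exact hinf (Module.Basis.finiteDimensional_of_finite b.toOrthonormalBasis.toBasis)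
  obtain ⟨f⟩ : Nonempty (ℕ × w ≃ w) := by
    rw [← Cardinal.lift_mk_eq']
    simp [Cardinal.aleph0_mul_eq]
  have hg : ∀ n, Function.Injective (fun i => f (n, i)) := fun n i j h => by
    simpa using h
  have ho : ∀ n, Orthonormal ℂ (fun i => b (f (n, i))) := fun n =>
    b.orthonormal.comp _ (hg n)
  let S : ℕ → (H →ₗᵢ[ℂ] H) := fun n =>
    (ho n).orthogonalFamily.linearIsometry.comp b.repr.toLinearIsometry
  have hS : ∀ n i, S n (b i) = b (f (n, i)) := by
    intro n i
    change (ho n).orthogonalFamily.linearIsometry (b.repr (b i)) = _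
    rw [HilbertBasis.repr_self]
    have := (ho n).orthogonalFamily.linearIsometry_apply_single (i := i) (1 : ℂ)
    rw [this]
    simp
  refine ⟨fun n => (S n).toContinuousLinearMap,
    fun n => star (S n).toContinuousLinearMap, fun n => (S n).norm_toContinuousLinearMap_le, ?_⟩
  intro m n
  refine ContinuousLinearMap.ext_on (s := Set.range b) ?_ ?_
  · exact Submodule.dense_iff_topologicalClosure_eq_top.2 b.dense_span
  · rintro _ ⟨i, rfl⟩
    apply b.repr.injective
    ext j
    beta_reduce
    rw [b.repr_apply_apply, b.repr_apply_apply, mul_apply_eq_comp,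
      ContinuousLinearMap.star_eq_adjoint, ContinuousLinearMap.adjoint_inner_right]
    simp only [LinearIsometry.coe_toContinuousLinearMap, hS]
    rw [orthonormal_iff_ite.1 b.orthonormal]
    have ho' := orthonormal_iff_ite.1 b.orthonormal
    clear hb
    by_cases hmn : m = n
    · by_cases hij : j = i
      · simp [hmn, hij, b.orthonormal.1]
      · simp [hmn, hij, ho']
    · simp [hmn]

lemma sb_family (hinf : ¬FiniteDimensional ℂ H) :
    ∃ (V : Set.Ioo (0:ℝ) 1 → (H →L[ℂ] H)) (T : ℕ → (H →L[ℂ] H)),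
      ∀ t m, T m * V t = ((t : ℝ) : ℂ) ^ m • (1 : H →L[ℂ] H) := by
  obtain ⟨S, T, hS, hT⟩ := sb_isometries hinf
  refine ⟨fun t => ∑' n, ((t : ℝ) : ℂ) ^ n • S n, T, fun t m => ?_⟩
  have hsum : Summable (fun n => ((t : ℝ) : ℂ) ^ n • S n) := by
    refine Summable.of_norm_bounded (g := fun n => (t : ℝ) ^ n)
      (summable_geometric_of_lt_one t.2.1.le t.2.2) ?_
    intro n
    rw [norm_smul, norm_pow, Complex.norm_real, Real.norm_of_nonneg t.2.1.le]
    exact mul_le_of_le_one_right (pow_nonneg t.2.1.le _) (hS n)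
  have h1 := hsum.hasSum.mul_left (T m)
  have h2 : HasSum (fun n => T m * ((t : ℝ) : ℂ) ^ n • S n)
      (((t : ℝ) : ℂ) ^ m • (1 : H →L[ℂ] H)) := by
    have h3 := hasSum_single (f := fun n => T m * ((t : ℝ) : ℂ) ^ n • S n) m
      (fun n hn => by simp [hT, hn.symm])
    simpa only [mul_smul_comm, hT, if_true] using h3
  exact h1.unique h2

lemma sb_indep (F : Finset (Set.Ioo (0:ℝ) 1)) (c : Set.Ioo (0:ℝ) 1 → ℂ)
    (h : ∀ m : ℕ, ∑ t ∈ F, c t * ((t : ℝ) : ℂ) ^ m = 0) : ∀ t ∈ F, c t = 0 := by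
  have h1 := linearIndependent_monoidHom (Multiplicative ℕ) ℂ
  have hinj : Function.Injective
      (fun t : Set.Ioo (0:ℝ) 1 => powersHom ℂ ((t : ℝ) : ℂ)) := by
    intro s t hst
    have := (powersHom ℂ).injective hst
    exact Subtype.ext (Complex.ofReal_injective this)
  have h2 := h1.comp _ hinj
  rw [linearIndependent_iff'] at h2
  apply h2 F c
  ext m
  have := h m.toAdd
  simpa [Finset.sum_apply] using this

/-- The dimension of a span plus an ideal over the ideal. -/
lemma sb_dim (hinf : ¬FiniteDimensional ℂ H) (𝒮 : Set (H →L[ℂ] H))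
    (hcard : Cardinal.mk 𝒮 < Cardinal.continuum) (K : Submodule ℂ (H →L[ℂ] H))
    (hK : ∀ A, ∀ x ∈ K, A * x ∈ K) (X : H →L[ℂ] H)
    (hX : ∀ A : H →L[ℂ] H, A * X ∈ Submodule.span ℂ 𝒮 ⊔ K) : X ∈ K := by
  by_contra hXK
  obtain ⟨V, T, hVT⟩ := sb_family hinf
  let N := Submodule.span ℂ (K.mkQ '' 𝒮)
  have hmem : ∀ t, K.mkQ (V t * X) ∈ N := by
    intro t
    have := Submodule.mem_map_of_mem (f := K.mkQ) (hX (V t))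
    rw [Submodule.map_sup, Submodule.map_span] at this
    have h0 : K.map K.mkQ = ⊥ := by simp
    rw [h0, sup_bot_eq] at this
    exact this
  have hli0 : LinearIndependent ℂ (fun t => K.mkQ (V t * X)) := by
    rw [linearIndependent_iff']
    intro F c hc
    apply sb_indep
    intro m
    have h1 : (∑ t ∈ F, c t • (V t * X)) ∈ K := by
      rw [← Submodule.Quotient.mk_eq_zero, ← Submodule.mkQ_apply, map_sum]
      simpa using hc
    have h2 := hK (T m) _ h1
    have h3 : T m * (∑ t ∈ F, c t • (V t * X)) =
        (∑ t ∈ F, c t * ((t : ℝ) : ℂ) ^ m) • X := by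
      rw [Finset.mul_sum, Finset.sum_smul]
      refine Finset.sum_congr rfl fun t _ => ?_
      rw [mul_smul_comm, ← mul_assoc, hVT, smul_mul_assoc, one_mul, smul_smul]
    rw [h3] at h2
    by_contra hne
    exact hXK ((Submodule.smul_mem_iff _ hne).1 h2)
  have hli : LinearIndependent ℂ (fun t => (⟨K.mkQ (V t * X), hmem t⟩ : N)) :=
    LinearIndependent.of_comp N.subtype hli0
  have h1 := hli.cardinal_lift_le_rank
  rw [Cardinal.mk_Ioo_real (one_pos : (0:ℝ) < 1)] at h1
  have h2 : Module.rank ℂ N ≤ Cardinal.mk 𝒮 := (rank_span_le _).trans Cardinal.mk_image_le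
  have h3 := h2.trans_lt hcard
  simp at h1
  exact absurd h1 (not_le.2 h3)

lemma sb_smul {I : Set (H →L[ℂ] H)} (hI : IsBHIdeal I) (c : ℂ) {x : H →L[ℂ] H} (hx : x ∈ I) :
    c • x ∈ I := by
  have := hI.2.2.1 (c • 1) x hx
  simpa using this

def sbSub (I : Set (H →L[ℂ] H)) (hI : IsBHIdeal I) : Submodule ℂ (H →L[ℂ] H) where
  carrier := I
  zero_mem' := hI.1
  add_mem' := fun hx hy => hI.2.1 _ hx _ hy
  smul_mem' := fun c _ hx => sb_smul hI c hx

lemma sb_prod_sub {I J : Set (H →L[ℂ] H)} (M : AddSubmonoid (H →L[ℂ] H))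
    (h : ∀ x ∈ I, ∀ y ∈ J, x * y ∈ M) : ∀ T ∈ idealProd I J, T ∈ M := by
  rintro T ⟨n, X, Y, hX, hY, rfl⟩
  exact sum_mem fun i _ => h _ (hX i) _ (hY i)

lemma sb_prod_add {I J : Set (H →L[ℂ] H)} {S T : H →L[ℂ] H} (hS : S ∈ idealProd I J)
    (hT : T ∈ idealProd I J) : S + T ∈ idealProd I J := by
  obtain ⟨n, X, Y, hX, hY, rfl⟩ := hS
  obtain ⟨m, Z, W, hZ, hW, rfl⟩ := hT
  refine ⟨n + m, Fin.append X Z, Fin.append Y W, ?_, ?_, ?_⟩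
  · intro i
    refine Fin.addCases (fun i => ?_) (fun i => ?_) i <;> simp [hX, hZ]
  · intro i
    refine Fin.addCases (fun i => ?_) (fun i => ?_) i <;> simp [hY, hW]
  · simp [Fin.sum_univ_add]

lemma sb_prod_zero {I J : Set (H →L[ℂ] H)} : (0 : H →L[ℂ] H) ∈ idealProd I J :=
  ⟨0, 0, 0, fun i => i.elim0, fun i => i.elim0, by simp⟩

def sbProd (I J : Set (H →L[ℂ] H)) : AddSubmonoid (H →L[ℂ] H) where
  carrier := idealProd I J
  zero_mem' := sb_prod_zero
  add_mem' := sb_prod_add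

lemma sb_prod_mul {I J : Set (H →L[ℂ] H)} {x y : H →L[ℂ] H} (hx : x ∈ I) (hy : y ∈ J) :
    x * y ∈ idealProd I J :=
  ⟨1, fun _ => x, fun _ => y, fun _ => hx, fun _ => hy, by simp⟩

lemma sb_prod_ideal {I J : Set (H →L[ℂ] H)} (hI : IsBHIdeal I) (hJ : IsBHIdeal J) :
    IsBHIdeal (idealProd I J) := by
  refine ⟨sb_prod_zero, fun x hx y hy => sb_prod_add hx hy, ?_, ?_⟩
  · rintro A _ ⟨n, X, Y, hX, hY, rfl⟩
    refine ⟨n, fun i => A * X i, Y, fun i => hI.2.2.1 _ _ (hX i), hY, ?_⟩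
    simp [Finset.mul_sum, mul_assoc]
  · rintro A _ ⟨n, X, Y, hX, hY, rfl⟩
    refine ⟨n, X, fun i => Y i * A, hX, fun i => hJ.2.2.2 _ _ (hY i), ?_⟩
    simp [Finset.sum_mul, mul_assoc]

lemma sb_prod_comm {I J : Set (H →L[ℂ] H)} (hI : IsBHIdeal I) (hJ : IsBHIdeal J) :
    idealProd I J ⊆ idealProd J I := by
  intro T hT
  obtain ⟨n, X, Y, hX, hY, h⟩ := sb_star_mem (sb_prod_ideal hI hJ) hT
  refine ⟨n, fun i => star (Y i), fun i => star (X i), fun i => sb_star_mem hJ (hY i),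
    fun i => sb_star_mem hI (hX i), ?_⟩
  rw [← star_star T, h]
  simp

lemma sb_gen_ideal (𝒮 : Set (H →L[ℂ] H)) : IsBHIdeal (idealGen 𝒮) :=
  ⟨fun _ hI => hI.1.1,
    fun x hx y hy I hI => hI.1.2.1 x (hx I hI) y (hy I hI),
    fun A x hx I hI => hI.1.2.2.1 A x (hx I hI),
    fun A x hx I hI => hI.1.2.2.2 A x (hx I hI)⟩

lemma sb_gen_sub {J 𝒮 : Set (H →L[ℂ] H)} (hJ : IsBHIdeal J) (h𝒮 : 𝒮 ⊆ J) :
    IsSubideal J (subidealGen J 𝒮) := by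
  refine ⟨fun x hx => hx J ⟨⟨subset_rfl, hJ.1, hJ.2.1, fun c x hx => sb_smul hJ c hx,
      fun A _ x hx => ⟨hJ.2.2.1 _ _ hx, hJ.2.2.2 _ _ hx⟩⟩, h𝒮⟩, fun _ hI => hI.1.2.1,
    fun x hx y hy I hI => hI.1.2.2.1 x (hx I hI) y (hy I hI),
    fun c x hx I hI => hI.1.2.2.2.1 c x (hx I hI),
    fun A hA x hx => ⟨fun I hI => (hI.1.2.2.2.2 A hA x (hx I hI)).1,
      fun I hI => (hI.1.2.2.2.2 A hA x (hx I hI)).2⟩⟩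

/-- for `|𝒮| < 𝔠`, `(𝒮)_J` is a `B(H)`-ideal iff `(𝒮)` is `J`-soft. -/
theorem subideal_isBHIdeal_iff_soft (J : Set (H →L[ℂ] H)) (hJ : IsBHIdeal J)
    (hinf : ¬FiniteDimensional ℂ H) (𝒮 : Set (H →L[ℂ] H)) (h𝒮 : 𝒮 ⊆ J)
    (hcard : Cardinal.mk 𝒮 < Cardinal.continuum) :
    IsBHIdeal (subidealGen J 𝒮) ↔ idealProd (idealGen 𝒮) J = idealGen 𝒮 := by
  have hI := sb_gen_ideal 𝒮
  have hG := sb_gen_sub hJ h𝒮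
  have hSI : 𝒮 ⊆ idealGen 𝒮 := fun x hx I hI => hI.2 hx
  have hSG : 𝒮 ⊆ subidealGen J 𝒮 := fun x hx I hI => hI.2 hx
  have hIJ : idealGen 𝒮 ⊆ J := fun x hx => hx J ⟨hJ, h𝒮⟩
  constructor
  · intro hGI
    have hIG : idealGen 𝒮 ⊆ subidealGen J 𝒮 := fun x hx => hx _ ⟨hGI, hSG⟩
    have hprod : idealProd (idealGen 𝒮) J ⊆ idealGen 𝒮 :=
      sb_prod_sub (sbSub _ hI).toAddSubmonoid fun x hx y _ => hI.2.2.2 y x hx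
    have hP := sb_prod_ideal hI hJ
    let K := sbSub _ hP
    have hNI : ∀ x ∈ Submodule.span ℂ 𝒮 ⊔ K, x ∈ idealGen 𝒮 := by
      have : Submodule.span ℂ 𝒮 ⊔ K ≤ sbSub _ hI :=
        sup_le (Submodule.span_le.2 hSI) hprod
      exact this
    have hN : IsSubideal J ((Submodule.span ℂ 𝒮 ⊔ K : Submodule ℂ (H →L[ℂ] H)) : Set _) := by
      refine ⟨fun x hx => hIJ (hNI x hx), zero_mem _, fun x hx y hy => add_mem hx hy,
        fun c x hx => Submodule.smul_mem _ c hx, fun A hA x hx => ⟨?_, ?_⟩⟩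
      · exact Submodule.mem_sup_right (S := Submodule.span ℂ 𝒮) (T := K)
          (sb_prod_comm hJ hI (sb_prod_mul hA (hNI x hx)))
      · exact Submodule.mem_sup_right (S := Submodule.span ℂ 𝒮) (T := K)
          (sb_prod_mul (hNI x hx) hA)
    refine subset_antisymm hprod fun X hX => ?_
    refine sb_dim hinf 𝒮 hcard K (fun A x hx => hP.2.2.1 A x hx) X fun A => ?_
    exact hIG (hI.2.2.1 A X hX) _
      ⟨hN, Submodule.subset_span.trans (SetLike.coe_subset_coe.2 le_sup_left)⟩
  · intro hsoft
    have hGs : subidealGen J 𝒮 ⊆ idealGen 𝒮 := fun x hx => hx _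
      ⟨⟨hIJ, hI.1, hI.2.1, fun c x hx => sb_smul hI c hx,
        fun A _ x hx => ⟨hI.2.2.1 _ _ hx, hI.2.2.2 _ _ hx⟩⟩, hSI⟩
    let G : AddSubmonoid (H →L[ℂ] H) :=
      { carrier := subidealGen J 𝒮
        zero_mem' := hG.2.1
        add_mem' := fun hx hy => hG.2.2.1 _ hx _ hy }
    have hM : IsBHIdeal {x : H →L[ℂ] H | ∀ a ∈ J, ∀ b ∈ J, a * x * b ∈ subidealGen J 𝒮} := by
      refine ⟨?_, ?_, ?_, ?_⟩
      · intro a _ b _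
        simpa using hG.2.1
      · intro x hx y hy a ha b hb
        rw [mul_add, add_mul]
        exact hG.2.2.1 _ (hx a ha b hb) _ (hy a ha b hb)
      · intro A x hx a ha b hb
        rw [← mul_assoc]
        exact hx _ (hJ.2.2.2 A a ha) b hb
      · intro A x hx a ha b hb
        rw [mul_assoc, mul_assoc, ← mul_assoc]
        exact hx a ha _ (hJ.2.2.1 A b hb)
    have hIM : ∀ x ∈ idealGen 𝒮, ∀ a ∈ J, ∀ b ∈ J, a * x * b ∈ subidealGen J 𝒮 := by
      intro x hx
      refine hx _ ⟨hM, fun s hs a ha b hb => ?_⟩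
      exact (hG.2.2.2.2 b hb _ (hG.2.2.2.2 a ha s (hSG hs)).1).2
    have hIG : idealGen 𝒮 ⊆ subidealGen J 𝒮 := by
      rw [← hsoft]
      refine sb_prod_sub G fun x hx y hy => ?_
      rw [← hsoft] at hx
      obtain ⟨n, X, Y, hX, hY, rfl⟩ := sb_prod_comm hI hJ hx
      rw [Finset.sum_mul]
      exact sum_mem fun i _ => hIM _ (hY i) _ (hX i) _ hy
    rw [subset_antisymm hGs hIG]
    exact hI
end

section
/- Let J be a B(H)-ideal and 𝒮 ⊆ J. Define (𝒮)_J^0 := span_ℂ({AX : A ∈ J, X ∈ 𝒮} ∪ {XA : A ∈ J, X ∈ 𝒮}) + J(𝒮)J, where J(𝒮)J is the set of finite sums Σ A_iX_iB_i with A_i, B_i ∈ J and X_i ∈ (𝒮). Then the Hamel dimension (rank over ℂ) of the quotient vector space (𝒮)_J/(𝒮)_J^0 is at most the cardinality of 𝒮. -/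
open Pointwise

variable {H : Type*} [NormedAddCommGroup H] [InnerProductSpace ℂ H] [CompleteSpace H]
  [TopologicalSpace.SeparableSpace H]

/-- The generators of `(𝒮)_J⁰`, without grouping into sums. -/
def genZero (J 𝒮 : Set (H →L[ℂ] H)) : Set (H →L[ℂ] H) :=
  {T | (∃ A ∈ J, ∃ X ∈ 𝒮, T = A * X) ∨ (∃ A ∈ J, ∃ X ∈ 𝒮, T = X * A) ∨
    ∃ A ∈ J, ∃ X ∈ idealGen 𝒮, ∃ B ∈ J, T = A * X * B}

theorem subset_idealGen (𝒮 : Set (H →L[ℂ] H)) : 𝒮 ⊆ idealGen 𝒮 :=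
  fun _ hx _ hI => hI.2 hx

theorem span_genZero_le (J 𝒮 : Set (H →L[ℂ] H)) :
    Submodule.span ℂ (genZero J 𝒮) ≤
      Submodule.span ℂ
            (((Submodule.span ℂ
                ({T | ∃ A ∈ J, ∃ X ∈ 𝒮, T = A * X} ∪
                  {T | ∃ A ∈ J, ∃ X ∈ 𝒮, T = X * A}) : Submodule ℂ (H →L[ℂ] H)) :
                Set (H →L[ℂ] H)) + JSJ J 𝒮) := by
  have h0 : (0 : H →L[ℂ] H) ∈ JSJ J 𝒮 :=
    ⟨0, fun _ => 0, fun _ => 0, fun _ => 0, fun i => i.elim0, fun i => i.elim0,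
      fun i => i.elim0, by simp⟩
  refine Submodule.span_le.2 ?_
  rintro T (h | h | ⟨A, hA, X, hX, B, hB, rfl⟩)
  · exact Submodule.subset_span ⟨T, Submodule.subset_span (Or.inl h), 0, h0, add_zero T⟩
  · exact Submodule.subset_span ⟨T, Submodule.subset_span (Or.inr h), 0, h0, add_zero T⟩
  · refine Submodule.subset_span ⟨0, Submodule.zero_mem _, A * X * B, ?_, zero_add _⟩
    exact ⟨1, fun _ => A, fun _ => X, fun _ => B, fun _ => hA, fun _ => hB, fun _ => hX, by simp⟩

theorem isSubideal_aux (J 𝒮 : Set (H →L[ℂ] H)) (hJ : IsBHIdeal J) (h𝒮 : 𝒮 ⊆ J) :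
    IsSubideal J
      ((Submodule.span ℂ 𝒮 ⊔ Submodule.span ℂ (genZero J 𝒮) : Submodule ℂ (H →L[ℂ] H)) :
        Set (H →L[ℂ] H)) := by
  obtain ⟨hz, hadd, hl, hr⟩ := hJ
  rw [← Submodule.span_union]
  refine ⟨?_, Submodule.zero_mem _, fun x hx y hy => Submodule.add_mem _ hx hy,
    fun c x hx => Submodule.smul_mem _ c hx, ?_⟩
  · intro x hx
    induction hx using Submodule.span_induction with
    | mem x hx =>
      rcases hx with hx | ⟨A, hA, X, hX, rfl⟩ | ⟨A, hA, X, hX, rfl⟩ | ⟨A, hA, X, hX, B, hB, rfl⟩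
      · exact h𝒮 hx
      · exact hr _ _ hA
      · exact hl _ _ hA
      · exact hl _ _ hB
    | zero => exact hz
    | add x y _ _ hx hy => exact hadd x hx y hy
    | smul c x _ hx =>
      have := hl (c • 1) x hx
      simpa using this
  · intro C hC x hx
    have key : ∀ T, T ∈ genZero J 𝒮 → T ∈ Submodule.span ℂ (𝒮 ∪ genZero J 𝒮) :=
      fun T hT => Submodule.subset_span (Or.inr hT)
    induction hx using Submodule.span_induction with
    | mem x hx =>
      rcases hx with hx | ⟨A, hA, X, hX, rfl⟩ | ⟨A, hA, X, hX, rfl⟩ | ⟨A, hA, X, hX, B, hB, rfl⟩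
      · exact ⟨key _ (Or.inl ⟨C, hC, x, hx, rfl⟩), key _ (Or.inr (Or.inl ⟨C, hC, x, hx, rfl⟩))⟩
      · exact ⟨key _ (Or.inl ⟨C * A, hl _ _ hA, X, hX, (mul_assoc _ _ _).symm⟩),
          key _ (Or.inr (Or.inr ⟨A, hA, X, subset_idealGen 𝒮 hX, C, hC, rfl⟩))⟩
      · exact ⟨key _ (Or.inr (Or.inr ⟨C, hC, X, subset_idealGen 𝒮 hX, A, hA,
            (mul_assoc _ _ _).symm⟩)),
          key _ (Or.inr (Or.inl ⟨A * C, hl _ _ hC, X, hX, mul_assoc _ _ _⟩))⟩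
      · exact ⟨key _ (Or.inr (Or.inr ⟨C * A, hl _ _ hA, X, hX, B, hB, by simp only [mul_assoc]⟩)),
          key _ (Or.inr (Or.inr ⟨A, hA, X, hX, B * C, hl _ _ hC, by simp only [mul_assoc]⟩))⟩
    | zero => simp
    | add x y _ _ hx hy =>
      rw [mul_add, add_mul]
      exact ⟨Submodule.add_mem _ hx.1 hy.1, Submodule.add_mem _ hx.2 hy.2⟩
    | smul c x _ hx =>
      rw [mul_smul_comm, smul_mul_assoc]
      exact ⟨Submodule.smul_mem _ c hx.1, Submodule.smul_mem _ c hx.2⟩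

theorem rank_quotient_aux {V : Type*} [AddCommGroup V] [Module ℂ V] (S : Set V)
    (K M : Submodule ℂ V) (hS : Submodule.span ℂ S ≤ K) (hK : K ≤ Submodule.span ℂ S ⊔ M) :
    Module.rank ℂ (↥K ⧸ Submodule.comap K.subtype M) ≤ Cardinal.mk S := by
  refine le_trans (LinearMap.rank_le_of_surjective
    ((Submodule.comap K.subtype M).mkQ ∘ₗ Submodule.inclusion hS) ?_) (rank_span_le S)
  intro q
  obtain ⟨⟨x, hx⟩, rfl⟩ := Submodule.mkQ_surjective _ q
  obtain ⟨s, hs, m, hm, rfl⟩ := Submodule.mem_sup.1 (hK hx)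
  refine ⟨⟨s, hs⟩, ?_⟩
  symm
  simp only [LinearMap.comp_apply, Submodule.mkQ_apply]
  rw [Submodule.Quotient.eq]
  simpa using hm

/-- the Hamel dimension of `(𝒮)_J / (𝒮)_J⁰` is at most the cardinality of `𝒮`,
where `(𝒮)_J⁰ = span(J𝒮 ∪ 𝒮J) + J(𝒮)J`. -/
theorem quotient_rank_le_card (J 𝒮 : Set (H →L[ℂ] H)) (hJ : IsBHIdeal J)
    (hinf : ¬FiniteDimensional ℂ H) (h𝒮 : 𝒮 ⊆ J) :
    Module.rank ℂ
      (↥(Submodule.span ℂ (subidealGen J 𝒮)) ⧸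
        (Submodule.comap (Submodule.span ℂ (subidealGen J 𝒮)).subtype
          (Submodule.span ℂ
            (((Submodule.span ℂ
                ({T | ∃ A ∈ J, ∃ X ∈ 𝒮, T = A * X} ∪
                  {T | ∃ A ∈ J, ∃ X ∈ 𝒮, T = X * A}) : Submodule ℂ (H →L[ℂ] H)) :
                Set (H →L[ℂ] H)) + JSJ J 𝒮)))) ≤ Cardinal.mk 𝒮 := by
  refine rank_quotient_aux 𝒮 _ _ ?_ ?_
  · exact Submodule.span_mono fun x hx I hI => hI.2 hx
  · refine le_trans ?_ (sup_le_sup_left (span_genZero_le J 𝒮) _)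
    refine Submodule.span_le.2 fun x hx => hx _ ⟨isSubideal_aux J 𝒮 hJ h𝒮, ?_⟩
    exact fun y hy => Submodule.mem_sup_left (Submodule.subset_span hy)
end

section
/- Let J be a B(H)-ideal and 𝒮 ⊆ J a set whose cardinality is strictly less than the cardinality of the continuum. Then the smallest J-ideal containing 𝒮 satisfies (𝒮)_J = span_ℂ(𝒮 ∪ {AX : A ∈ J, X ∈ 𝒮} ∪ {XA : A ∈ J, X ∈ 𝒮}) + J(𝒮)J, where J(𝒮)J is the set of finite sums Σ A_iX_iB_i with A_i, B_i ∈ J and X_i ∈ (𝒮). -/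
open Pointwise

variable {H : Type*} [NormedAddCommGroup H] [InnerProductSpace ℂ H] [CompleteSpace H]
  [TopologicalSpace.SeparableSpace H]

theorem IsBHIdeal.smul_mem' {J : Set (H →L[ℂ] H)} (hJ : IsBHIdeal J) (c : ℂ)
    {x : H →L[ℂ] H} (hx : x ∈ J) : c • x ∈ J := by
  have := hJ.2.2.1 (c • 1) x hx
  simpa using this

/-- An ideal as a submodule. -/
def bhSubmodule (J : Set (H →L[ℂ] H)) (hJ : IsBHIdeal J) : Submodule ℂ (H →L[ℂ] H) where
  carrier := J
  zero_mem' := hJ.1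
  add_mem' := fun {x y} hx hy => hJ.2.1 x hx y hy
  smul_mem' := fun c _ hx => hJ.smul_mem' c hx

theorem JSJ_eq_span (J 𝒮 : Set (H →L[ℂ] H)) (hJ : IsBHIdeal J) :
    JSJ J 𝒮 = (Submodule.span ℂ
      {T | ∃ A ∈ J, ∃ B ∈ J, ∃ X ∈ idealGen 𝒮, T = A * X * B} : Set (H →L[ℂ] H)) := by
  apply Set.Subset.antisymm
  · rintro T ⟨n, A, X, B, hA, hB, hX, rfl⟩
    exact Submodule.sum_mem _ fun i _ =>
      Submodule.subset_span ⟨A i, hA i, B i, hB i, X i, hX i, rfl⟩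
  · intro T hT
    induction hT using Submodule.span_induction with
    | mem x h =>
      obtain ⟨A, hA, B, hB, X, hX, rfl⟩ := h
      exact ⟨1, fun _ => A, fun _ => X, fun _ => B, fun _ => hA, fun _ => hB, fun _ => hX,
        by simp⟩
    | zero =>
      exact ⟨0, Fin.elim0, Fin.elim0, Fin.elim0, fun i => i.elim0, fun i => i.elim0,
        fun i => i.elim0, by simp⟩
    | add x y _ _ hx hy =>
      obtain ⟨n, A, X, B, hA, hB, hX, rfl⟩ := hx
      obtain ⟨m, A', X', B', hA', hB', hX', rfl⟩ := hy
      refine ⟨n + m, Fin.append A A', Fin.append X X', Fin.append B B', ?_, ?_, ?_, ?_⟩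
      · intro i; refine Fin.addCases ?_ ?_ i <;> intro j <;> simp [hA, hA']
      · intro i; refine Fin.addCases ?_ ?_ i <;> intro j <;> simp [hB, hB']
      · intro i; refine Fin.addCases ?_ ?_ i <;> intro j <;> simp [hX, hX']
      · simp [Fin.sum_univ_add]
    | smul c x _ hx =>
      obtain ⟨n, A, X, B, hA, hB, hX, rfl⟩ := hx
      exact ⟨n, fun i => c • A i, X, B, fun i => hJ.smul_mem' c (hA i), hB, hX, by
        simp [Finset.smul_sum]⟩

theorem mul_mem_of_idealGen {J I 𝒮 : Set (H →L[ℂ] H)} (hJ : IsBHIdeal J)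
    (hI : IsSubideal J I) (hS : 𝒮 ⊆ I) {X : H →L[ℂ] H} (hX : X ∈ idealGen 𝒮) :
    ∀ A ∈ J, ∀ B ∈ J, A * X * B ∈ I := by
  obtain ⟨-, h0, hadd, -, hmul⟩ := hI
  refine hX {X | ∀ A ∈ J, ∀ B ∈ J, A * X * B ∈ I} ⟨⟨?_, ?_, ?_, ?_⟩, ?_⟩
  · intro A _ B _; simpa using h0
  · intro x hx y hy A hA B hB
    rw [mul_add, add_mul]
    exact hadd _ (hx A hA B hB) _ (hy A hA B hB)
  · intro C x hx A hA B hB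
    rw [← mul_assoc]
    exact hx _ (hJ.2.2.2 C A hA) B hB
  · intro C x hx A hA B hB
    rw [← mul_assoc, mul_assoc _ C B]
    exact hx A hA _ (hJ.2.2.1 C B hB)
  · intro x hx A hA B hB
    exact (hmul B hB _ (hmul A hA x (hS hx)).1).2

/-- structure theorem for `(𝒮)_J` when `|𝒮| < 𝔠`:
`(𝒮)_J = span(𝒮 ∪ J𝒮 ∪ 𝒮J) + J(𝒮)J`. -/
theorem subideal_structure (J 𝒮 : Set (H →L[ℂ] H)) (hJ : IsBHIdeal J)
    (hinf : ¬FiniteDimensional ℂ H) (h𝒮 : 𝒮 ⊆ J)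
    (hcard : Cardinal.mk 𝒮 < Cardinal.continuum) :
    subidealGen J 𝒮 =
      ((Submodule.span ℂ
          (𝒮 ∪ {T | ∃ A ∈ J, ∃ X ∈ 𝒮, T = A * X} ∪
            {T | ∃ A ∈ J, ∃ X ∈ 𝒮, T = X * A}) : Submodule ℂ (H →L[ℂ] H)) :
          Set (H →L[ℂ] H)) + JSJ J 𝒮 := by
  classical
  rw [JSJ_eq_span J 𝒮 hJ, ← Submodule.coe_sup]
  set P := {T : H →L[ℂ] H | ∃ A ∈ J, ∃ X ∈ 𝒮, T = A * X} with hP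
  set Q := {T : H →L[ℂ] H | ∃ A ∈ J, ∃ X ∈ 𝒮, T = X * A} with hQ
  set R := {T : H →L[ℂ] H | ∃ A ∈ J, ∃ B ∈ J, ∃ X ∈ idealGen 𝒮, T = A * X * B} with hR
  rw [← Submodule.span_union]
  apply Set.Subset.antisymm
  · intro T hT
    refine hT _ ⟨⟨?_, Submodule.zero_mem _, fun x hx y hy => Submodule.add_mem _ hx hy,
      fun c x hx => Submodule.smul_mem _ c hx, ?_⟩, ?_⟩
    · change Submodule.span ℂ (𝒮 ∪ P ∪ Q ∪ R) ≤ bhSubmodule J hJ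
      rw [Submodule.span_le]
      rintro x (((hx | ⟨A, hA, X, hX, rfl⟩) | ⟨A, hA, X, hX, rfl⟩) |
        ⟨A, hA, B, hB, X, hX, rfl⟩)
      · exact h𝒮 hx
      · exact hJ.2.2.2 _ _ hA
      · exact hJ.2.2.1 _ _ hA
      · exact hJ.2.2.1 _ _ hB
    · intro C hC x hx
      have mP : ∀ A ∈ J, ∀ X ∈ 𝒮, A * X ∈ Submodule.span ℂ (𝒮 ∪ P ∪ Q ∪ R) :=
        fun A hA X hX => Submodule.subset_span (Or.inl (Or.inl (Or.inr ⟨A, hA, X, hX, rfl⟩)))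
      have mQ : ∀ A ∈ J, ∀ X ∈ 𝒮, X * A ∈ Submodule.span ℂ (𝒮 ∪ P ∪ Q ∪ R) :=
        fun A hA X hX => Submodule.subset_span (Or.inl (Or.inr ⟨A, hA, X, hX, rfl⟩))
      have mR : ∀ A ∈ J, ∀ B ∈ J, ∀ X ∈ idealGen 𝒮,
          A * X * B ∈ Submodule.span ℂ (𝒮 ∪ P ∪ Q ∪ R) :=
        fun A hA B hB X hX => Submodule.subset_span (Or.inr ⟨A, hA, B, hB, X, hX, rfl⟩)
      change C * x ∈ Submodule.span ℂ (𝒮 ∪ P ∪ Q ∪ R) ∧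
        x * C ∈ Submodule.span ℂ (𝒮 ∪ P ∪ Q ∪ R)
      induction hx using Submodule.span_induction with
      | mem x h =>
        rcases h with (((hx | ⟨A, hA, X, hX, rfl⟩) | ⟨A, hA, X, hX, rfl⟩) |
          ⟨A, hA, B, hB, X, hX, rfl⟩)
        · exact ⟨mP C hC x hx, mQ C hC x hx⟩
        · refine ⟨?_, mR A hA C hC X (subset_idealGen 𝒮 hX)⟩
          rw [← mul_assoc]
          exact mP _ (hJ.2.2.1 C A hA) X hX
        · constructor
          · rw [← mul_assoc]
            exact mR C hC A hA X (subset_idealGen 𝒮 hX)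
          · rw [mul_assoc]
            exact mQ _ (hJ.2.2.1 A C hC) X hX
        · constructor
          · rw [← mul_assoc, ← mul_assoc]
            exact mR _ (hJ.2.2.1 C A hA) B hB X hX
          · rw [mul_assoc]
            exact mR A hA _ (hJ.2.2.1 B C hC) X hX
      | zero => simp
      | add x y _ _ hx hy =>
        rw [mul_add, add_mul]
        exact ⟨Submodule.add_mem _ hx.1 hy.1, Submodule.add_mem _ hx.2 hy.2⟩
      | smul c x _ hx =>
        rw [mul_smul_comm, smul_mul_assoc]
        exact ⟨Submodule.smul_mem _ c hx.1, Submodule.smul_mem _ c hx.2⟩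
    · exact fun x hx => Submodule.subset_span (Or.inl (Or.inl (Or.inl hx)))
  · rintro T hT I ⟨hI, hS⟩
    induction hT using Submodule.span_induction with
    | mem x h =>
      rcases h with (((hx | ⟨A, hA, X, hX, rfl⟩) | ⟨A, hA, X, hX, rfl⟩) |
        ⟨A, hA, B, hB, X, hX, rfl⟩)
      · exact hS hx
      · exact (hI.2.2.2.2 A hA X (hS hX)).1
      · exact (hI.2.2.2.2 A hA X (hS hX)).2
      · exact mul_mem_of_idealGen hJ hI hS hX A hA B hB
    | zero => exact hI.2.1
    | add x y _ _ hx hy => exact hI.2.2.1 _ hx _ hy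
    | smul c x _ hx => exact hI.2.2.2.1 c _ hx
end
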